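/- arXiv:2511.18432 — 3 statements merged into one kernel-verified Lean document; each statement's English description precedes it below -/
import Mathlib

section
/- Under the permutation null distribution, for n ≥ 2 and every integer t with 1 ≤ t ≤ n−1, Var(R_in,1(t)) = [t(n−t)/(n(n−1))] · ( Σ_u D_uu² − |G_in|²/n ). -/
open scoped BigOperators Classical

noncomputable section

namespace CPD

/-- Nodes: `n` individuals, each with `ℓ` repeated measurements. -/
abbrev Node (n ℓ : ℕ) := Fin n × Fin ℓ

/-- The (unordered) pair of individuals joined by an edge. -/
def indPair {n ℓ : ℕ} (e : Sym2 (Node n ℓ)) : Sym2 (Fin n) := Sym2.map Prod.fst e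

/-- Between-individual edges of the graph `Gr`. -/
def Gout {n ℓ : ℕ} (Gr : Finset (Sym2 (Node n ℓ))) : Finset (Sym2 (Node n ℓ)) :=
  Gr.filter fun e => ¬ (indPair e).IsDiag

/-- Within-individual edges of the graph `Gr`. -/
def Gin {n ℓ : ℕ} (Gr : Finset (Sym2 (Node n ℓ))) : Finset (Sym2 (Node n ℓ)) :=
  Gr.filter fun e => (indPair e).IsDiag

/-- `D Gr u v`: the number of edges of `Gr` between individual `u` and individual `v`
(for `u = v`, the number of within-individual edges of individual `u`). -/
def D {n ℓ : ℕ} (Gr : Finset (Sym2 (Node n ℓ))) (u v : Fin n) : ℕ :=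
  (Gr.filter fun e => indPair e = s(u, v)).card

/-- `Ddeg Gr u = ∑_{v ≠ u} D Gr u v`. -/
def Ddeg {n ℓ : ℕ} (Gr : Finset (Sym2 (Node n ℓ))) (u : Fin n) : ℕ :=
  ∑ v ∈ Finset.univ.filter fun v => v ≠ u, D Gr u v

/-- Number of between-individual edges both of whose endpoints belong to individuals whose
permuted label (in `{1, …, n}`) is `≤ t`. -/
def Rout1 {n ℓ : ℕ} (Gr : Finset (Sym2 (Node n ℓ))) (t : ℕ) (σ : Equiv.Perm (Fin n)) : ℕ :=
  ((Gout Gr).filter fun e => ∀ x ∈ e, ((σ x.1 : ℕ) + 1 ≤ t)).card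

/-- Number of between-individual edges both of whose endpoints belong to individuals whose
permuted label is `> t`. -/
def Rout2 {n ℓ : ℕ} (Gr : Finset (Sym2 (Node n ℓ))) (t : ℕ) (σ : Equiv.Perm (Fin n)) : ℕ :=
  ((Gout Gr).filter fun e => ∀ x ∈ e, (t ≤ (σ x.1 : ℕ))).card

/-- Number of within-individual edges both of whose endpoints belong to individuals whose
permuted label is `≤ t`. -/
def Rin1 {n ℓ : ℕ} (Gr : Finset (Sym2 (Node n ℓ))) (t : ℕ) (σ : Equiv.Perm (Fin n)) : ℕ :=
  ((Gin Gr).filter fun e => ∀ x ∈ e, ((σ x.1 : ℕ) + 1 ≤ t)).card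

/-- Expectation under the permutation null distribution (uniform over the `n!` permutations of
the individual labels). -/
def pexp {n : ℕ} (f : Equiv.Perm (Fin n) → ℝ) : ℝ :=
  (∑ σ : Equiv.Perm (Fin n), f σ) / (Nat.factorial n)

/-- Covariance under the permutation null distribution. -/
def pcov {n : ℕ} (f g : Equiv.Perm (Fin n) → ℝ) : ℝ :=
  pexp fun σ => (f σ - pexp f) * (g σ - pexp g)

/-- Variance under the permutation null distribution. -/
def pvar {n : ℕ} (f : Equiv.Perm (Fin n) → ℝ) : ℝ := pcov f f

/-- The weighted edge-count statistic
`R_out,w(t) = ((n−t−1)·R_out,1(t) + (t−1)·R_out,2(t))/(n−2)`. -/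
def Routw {n ℓ : ℕ} (Gr : Finset (Sym2 (Node n ℓ))) (t : ℕ) (σ : Equiv.Perm (Fin n)) : ℝ :=
  (((n : ℝ) - t - 1) * (Rout1 Gr t σ : ℝ) + ((t : ℝ) - 1) * (Rout2 Gr t σ : ℝ)) / ((n : ℝ) - 2)

/-- The difference edge-count statistic `R_out,d(t) = R_out,1(t) − R_out,2(t)`. -/
def Routd {n ℓ : ℕ} (Gr : Finset (Sym2 (Node n ℓ))) (t : ℕ) (σ : Equiv.Perm (Fin n)) : ℝ :=
  (Rout1 Gr t σ : ℝ) - (Rout2 Gr t σ : ℝ)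

/-- Standardized weighted between-individual statistic `Z_out,w(t)`. -/
def Zoutw {n ℓ : ℕ} (Gr : Finset (Sym2 (Node n ℓ))) (t : ℕ) (σ : Equiv.Perm (Fin n)) : ℝ :=
  (Routw Gr t σ - pexp (Routw Gr t)) / Real.sqrt (pvar (Routw Gr t))

/-- Standardized difference statistic `Z_out,d(t)`. -/
def Zoutd {n ℓ : ℕ} (Gr : Finset (Sym2 (Node n ℓ))) (t : ℕ) (σ : Equiv.Perm (Fin n)) : ℝ :=
  (Routd Gr t σ - pexp (Routd Gr t)) / Real.sqrt (pvar (Routd Gr t))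

/-- Standardized within-individual statistic `Z_in(t)`. -/
def Zin {n ℓ : ℕ} (Gr : Finset (Sym2 (Node n ℓ))) (t : ℕ) (σ : Equiv.Perm (Fin n)) : ℝ :=
  ((Rin1 Gr t σ : ℝ) - pexp (fun τ => (Rin1 Gr t τ : ℝ))) /
    Real.sqrt (pvar (fun τ => (Rin1 Gr t τ : ℝ)))

/-- The constant
`ϱ = (Σ_u D_uu·D_u − (2/n)|G_in||G_out|) / sqrt((Σ_u D_u² − 4|G_out|²/n)(Σ_u D_uu² − |G_in|²/n))`. -/
def varrho {n ℓ : ℕ} (Gr : Finset (Sym2 (Node n ℓ))) : ℝ :=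
  ((∑ u : Fin n, (D Gr u u : ℝ) * (Ddeg Gr u : ℝ)) -
      2 / (n : ℝ) * ((Gin Gr).card : ℝ) * ((Gout Gr).card : ℝ)) /
    Real.sqrt (((∑ u : Fin n, (Ddeg Gr u : ℝ) ^ 2) - 4 * ((Gout Gr).card : ℝ) ^ 2 / (n : ℝ)) *
      ((∑ u : Fin n, (D Gr u u : ℝ) ^ 2) - ((Gin Gr).card : ℝ) ^ 2 / (n : ℝ)))


/-- Summing `f (σ u)` over all permutations counts every value of `f` equally often. -/
theorem card_mul_sum_perm_apply {n : ℕ} (f : Fin n → ℝ) (u : Fin n) :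
    (n : ℝ) * ∑ σ : Equiv.Perm (Fin n), f (σ u) = (n.factorial : ℝ) * ∑ k, f k := by
  have h : ∀ v : Fin n, ∑ σ : Equiv.Perm (Fin n), f (σ v) = ∑ σ : Equiv.Perm (Fin n), f (σ u) := by
    intro v
    refine Fintype.sum_equiv (Equiv.mulRight (Equiv.swap u v)) _ _ fun σ => ?_
    simp
  calc (n : ℝ) * ∑ σ : Equiv.Perm (Fin n), f (σ u)
      = ∑ v : Fin n, ∑ σ : Equiv.Perm (Fin n), f (σ v) := by simp [h]
    _ = ∑ σ : Equiv.Perm (Fin n), ∑ v, f (σ v) := Finset.sum_comm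
    _ = ∑ σ : Equiv.Perm (Fin n), ∑ k, f k :=
        Finset.sum_congr rfl fun σ _ => Equiv.sum_comp σ f
    _ = _ := by simp [Fintype.card_perm]

/-- Cross moments of a centred function of a uniform permutation at two distinct points. -/
theorem sum_perm_mul_of_ne {n : ℕ} (b : Fin n → ℝ) (hb : ∑ k, b k = 0) {u v : Fin n}
    (huv : v ≠ u) :
    ((n : ℝ) - 1) * ∑ σ : Equiv.Perm (Fin n), b (σ u) * b (σ v) =
      -∑ σ : Equiv.Perm (Fin n), b (σ u) ^ 2 := by
  have h : ∀ w ∈ Finset.univ.erase u, ∑ σ : Equiv.Perm (Fin n), b (σ u) * b (σ w) =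
      ∑ σ : Equiv.Perm (Fin n), b (σ u) * b (σ v) := by
    intro w hw
    refine Fintype.sum_equiv (Equiv.mulRight (Equiv.swap v w)) _ _ fun σ => ?_
    simp [Equiv.swap_apply_of_ne_of_ne huv.symm (Finset.ne_of_mem_erase hw).symm]
  have hcard : ((Finset.univ.erase u).card : ℝ) = (n : ℝ) - 1 := by
    rw [Finset.card_erase_of_mem (Finset.mem_univ u), Finset.card_univ, Fintype.card_fin,
      Nat.cast_sub (Nat.succ_le_of_lt (Fin.pos u)), Nat.cast_one]
  rw [← hcard, ← nsmul_eq_mul, ← Finset.sum_const, ← Finset.sum_congr rfl h, Finset.sum_comm,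
    ← Finset.sum_neg_distrib]
  refine Finset.sum_congr rfl fun σ _ => ?_
  have h0 : b (σ u) + ∑ w ∈ Finset.univ.erase u, b (σ w) = 0 := by
    rw [Finset.add_sum_erase _ (fun w => b (σ w)) (Finset.mem_univ u), Equiv.sum_comp σ b, hb]
  rw [← Finset.mul_sum, eq_neg_of_add_eq_zero_right h0]
  ring

/-- Second moment of a linear permutation statistic with centred scores. -/
theorem pexp_sq_sum_mul {n : ℕ} (hn : 2 ≤ n) (a b : Fin n → ℝ) (hb : ∑ k, b k = 0) :
    pexp (fun σ => (∑ u, a u * b (σ u)) * ∑ u, a u * b (σ u)) =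
      (∑ k, b k ^ 2) / ((n : ℝ) - 1) * ((∑ u, a u ^ 2) - (∑ u, a u) ^ 2 / (n : ℝ)) := by
  have hn' : (2 : ℝ) ≤ n := by exact_mod_cast hn
  have hn0 : (n : ℝ) ≠ 0 := by linarith
  have hn1 : (n : ℝ) - 1 ≠ 0 := by linarith
  have hf : (n.factorial : ℝ) ≠ 0 := by exact_mod_cast n.factorial_ne_zero
  set s : ℝ := n.factorial * (∑ k, b k ^ 2) / n with hs
  have hdiag : ∀ u, ∑ σ : Equiv.Perm (Fin n), b (σ u) ^ 2 = s := fun u => by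
    rw [hs, eq_div_iff hn0, mul_comm, card_mul_sum_perm_apply (fun k => b k ^ 2)]
  have hmom : ∀ u v, ∑ σ : Equiv.Perm (Fin n), b (σ u) * b (σ v) =
      (if v = u then s * n / (n - 1) else 0) - s / (n - 1) := by
    intro u v
    split_ifs with h
    · subst h
      simp only [← sq, hdiag]
      field_simp
    · have := sum_perm_mul_of_ne b hb h
      rw [hdiag] at this
      field_simp
      linarith
  have hsum : ∑ σ : Equiv.Perm (Fin n), (∑ u, a u * b (σ u)) * ∑ u, a u * b (σ u) =
      s * n / (n - 1) * (∑ u, a u ^ 2) - s / (n - 1) * (∑ u, a u) ^ 2 := by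
    calc _ = ∑ u, ∑ v, a u * a v * ∑ σ : Equiv.Perm (Fin n), b (σ u) * b (σ v) := by
          simp only [Finset.sum_mul_sum]
          rw [Finset.sum_comm]
          refine Finset.sum_congr rfl fun u _ => ?_
          rw [Finset.sum_comm]
          refine Finset.sum_congr rfl fun v _ => ?_
          rw [Finset.mul_sum]
          refine Finset.sum_congr rfl fun σ _ => ?_
          ring
      _ = _ := by
          simp only [hmom, mul_sub, Finset.sum_sub_distrib, mul_ite, mul_zero,
            Finset.sum_ite_eq', Finset.mem_univ, if_true, ← Finset.sum_mul]
          rw [sq (∑ u, a u), Finset.sum_mul_sum]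
          simp only [sq]
          ring
  rw [pexp, hsum, hs]
  field_simp

/-- Variance of a linear permutation statistic. -/
theorem pvar_sum_mul {n : ℕ} (hn : 2 ≤ n) (a c : Fin n → ℝ) :
    pvar (fun σ => ∑ u, a u * c (σ u)) =
      (∑ k, (c k - (∑ j, c j) / n) ^ 2) / ((n : ℝ) - 1) *
        ((∑ u, a u ^ 2) - (∑ u, a u) ^ 2 / (n : ℝ)) := by
  have hn0 : (n : ℝ) ≠ 0 := by positivity
  have hf : (n.factorial : ℝ) ≠ 0 := by exact_mod_cast n.factorial_ne_zero
  have hmean : pexp (fun σ => ∑ u, a u * c (σ u)) = ∑ u, a u * ((∑ j, c j) / n) := by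
    rw [pexp, Finset.sum_comm, Finset.sum_div]
    refine Finset.sum_congr rfl fun u _ => ?_
    have := card_mul_sum_perm_apply c u
    rw [← Finset.mul_sum, mul_div_assoc]
    congr 1
    rw [div_eq_div_iff hf hn0]
    linarith
  rw [← pexp_sq_sum_mul hn a]
  · simp only [pvar, pcov, hmean, mul_sub, Finset.sum_sub_distrib]
  · simp only [Finset.sum_sub_distrib, Finset.sum_const, Finset.card_univ, Fintype.card_fin,
      nsmul_eq_mul]
    field_simp
    ring

theorem indPair_eq_diag_iff {n ℓ : ℕ} (e : Sym2 (Node n ℓ)) (u : Fin n) :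
    indPair e = s(u, u) ↔ ∀ x ∈ e, x.1 = u := by
  induction e with
  | _ x y => simp [indPair]

theorem exists_indPair_eq_diag {n ℓ : ℕ} {e : Sym2 (Node n ℓ)} (he : (indPair e).IsDiag) :
    ∃ u, indPair e = s(u, u) := by
  induction e with
  | _ x y =>
    refine ⟨y.1, ?_⟩
    simp only [indPair, Sym2.map_mk, Sym2.mk_isDiag_iff] at he ⊢
    rw [he]

/-- Within-individual edges satisfying a property of their individual, counted by individual. -/
theorem card_Gin_filter {n ℓ : ℕ} (Gr : Finset (Sym2 (Node n ℓ))) (p : Fin n → Prop) :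
    ((Gin Gr).filter fun e => ∀ x ∈ e, p x.1).card = ∑ u, D Gr u u * if p u then 1 else 0 := by
  have h : ((Gin Gr).filter fun e => ∀ x ∈ e, p x.1) =
      (Finset.univ.filter p).biUnion fun u => Gr.filter fun e => indPair e = s(u, u) := by
    ext e
    simp only [Gin, Finset.mem_filter, Finset.mem_biUnion, Finset.mem_univ, true_and]
    constructor
    · rintro ⟨⟨he, hd⟩, hp⟩
      obtain ⟨u, hu⟩ := exists_indPair_eq_diag hd
      refine ⟨u, ?_, he, hu⟩
      rw [indPair_eq_diag_iff] at hu
      obtain ⟨x, hx⟩ : ∃ x, x ∈ e := ⟨_, e.out_fst_mem⟩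
      exact hu x hx ▸ hp x hx
    · rintro ⟨u, hpu, he, hu⟩
      refine ⟨⟨he, by simp [hu]⟩, fun x hx => ?_⟩
      rw [(indPair_eq_diag_iff e u).1 hu x hx]
      exact hpu
  rw [h, Finset.card_biUnion]
  · simp [Finset.sum_filter, D]
  · intro u _ v _ huv
    rw [Function.onFun, Finset.disjoint_filter]
    intro e _ hu hv
    rw [hu] at hv
    simp at hv
    exact huv hv

theorem Rin1_eq_sum {n ℓ : ℕ} (Gr : Finset (Sym2 (Node n ℓ))) (t : ℕ) (σ : Equiv.Perm (Fin n)) :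
    Rin1 Gr t σ = ∑ u, D Gr u u * if (σ u : ℕ) + 1 ≤ t then 1 else 0 := by
  have h := card_Gin_filter Gr fun u => (σ u : ℕ) + 1 ≤ t
  rw [Rin1]
  convert h

theorem card_Gin {n ℓ : ℕ} (Gr : Finset (Sym2 (Node n ℓ))) :
    (Gin Gr).card = ∑ u, D Gr u u := by
  simpa using card_Gin_filter Gr fun _ => True

theorem sum_indicator_lt {n t : ℕ} (ht : t ≤ n) :
    ∑ k : Fin n, (if (k : ℕ) + 1 ≤ t then (1 : ℝ) else 0) = t := by
  rw [Fin.sum_univ_eq_sum_range (fun k => if k + 1 ≤ t then (1 : ℝ) else 0) n,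
    ← Finset.sum_filter]
  have : (Finset.range n).filter (fun k => k + 1 ≤ t) = Finset.range t := by
    ext k
    simp only [Finset.mem_filter, Finset.mem_range]
    omega
  rw [this, Finset.sum_const, Finset.card_range, nsmul_one]

/-- Variance of `R_in,1(t)` under the permutation null distribution. -/
theorem variance_Rin1 (n ℓ : ℕ) (Gr : Finset (Sym2 (Node n ℓ)))
    (hG : ∀ e ∈ Gr, ¬ e.IsDiag) (hn : 2 ≤ n) (t : ℕ) (ht1 : 1 ≤ t) (ht2 : t ≤ n - 1) :
    pvar (fun σ => (Rin1 Gr t σ : ℝ)) =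
      (t : ℝ) * ((n : ℝ) - t) / ((n : ℝ) * ((n : ℝ) - 1)) *
        ((∑ u : Fin n, (D Gr u u : ℝ) ^ 2) - ((Gin Gr).card : ℝ) ^ 2 / (n : ℝ)) := by
  have hn0 : (n : ℝ) ≠ 0 := by positivity
  have hn1 : (n : ℝ) - 1 ≠ 0 := by
    have : (2 : ℝ) ≤ n := by exact_mod_cast hn
    linarith
  have hI := sum_indicator_lt (n := n) (t := t) (by omega)
  have hR : (fun σ => (Rin1 Gr t σ : ℝ)) = fun σ : Equiv.Perm (Fin n) =>
      ∑ u, (D Gr u u : ℝ) * if (σ u : ℕ) + 1 ≤ t then (1 : ℝ) else 0 := by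
    funext σ
    rw [Rin1_eq_sum]
    push_cast
    rfl
  have hsq : ∀ k : Fin n, ((if (k : ℕ) + 1 ≤ t then (1 : ℝ) else 0) - (t : ℝ) / n) ^ 2 =
      (1 - 2 * (t / n)) * (if (k : ℕ) + 1 ≤ t then (1 : ℝ) else 0) + (t / n) ^ 2 := by
    intro k
    split_ifs <;> ring
  rw [hR, pvar_sum_mul hn (fun u => (D Gr u u : ℝ))
    (fun k => if (k : ℕ) + 1 ≤ t then (1 : ℝ) else 0), card_Gin, hI]
  simp only [hsq, Finset.sum_add_distrib, ← Finset.mul_sum, hI, Finset.sum_const,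
    Finset.card_univ, Fintype.card_fin, nsmul_eq_mul]
  push_cast
  field_simp
  ring

end CPD
end
end

section
/- Under the permutation null distribution, for n ≥ 3 and every integer t with 1 ≤ t ≤ n−1, Cov(R_out,1(t), R_in,1(t)) = [t(t−1)(n−t)/(n(n−1)(n−2))] · ( Σ_{u=1}^n D_uu·D_u − (2/n)|G_in||G_out| ). -/
open scoped BigOperators Classical

noncomputable section

namespace CPD

/-- Indicator that individual `u` receives a permuted label (in `{1, …, n}`) at most `t`. -/
def lowInd {n : ℕ} (t : ℕ) (u : Fin n) (σ : Equiv.Perm (Fin n)) : ℝ :=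
  if (σ u : ℕ) + 1 ≤ t then 1 else 0

/-- Indicator that both endpoints of the edge `e` receive a permuted label at most `t`. -/
def edgeInd {n ℓ : ℕ} (t : ℕ) (e : Sym2 (Node n ℓ)) (σ : Equiv.Perm (Fin n)) : ℝ :=
  if ∀ x ∈ e, (σ x.1 : ℕ) + 1 ≤ t then 1 else 0

lemma lowInd_mul_self {n : ℕ} (t : ℕ) (u : Fin n) (σ : Equiv.Perm (Fin n)) :
    lowInd t u σ * lowInd t u σ = lowInd t u σ := by
  unfold lowInd; split_ifs <;> simp

lemma edgeInd_mk {n ℓ : ℕ} (t : ℕ) (x y : Node n ℓ) (σ : Equiv.Perm (Fin n)) :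
    edgeInd t s(x, y) σ = lowInd t x.1 σ * lowInd t y.1 σ := by
  simp only [edgeInd, lowInd, Sym2.mem_iff, forall_eq_or_imp, forall_eq, ite_and, ite_mul,
    one_mul, zero_mul]

lemma sum_lowInd {n t : ℕ} (ht : t ≤ n) (σ : Equiv.Perm (Fin n)) :
    ∑ u, lowInd t u σ = t := by
  unfold lowInd
  rw [Equiv.sum_comp σ fun i : Fin n => if (i : ℕ) + 1 ≤ t then (1 : ℝ) else 0,
    Fin.sum_univ_eq_sum_range fun i => if i + 1 ≤ t then (1 : ℝ) else 0]
  rw [Finset.sum_boole]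
  have : (Finset.range n).filter (fun i => i + 1 ≤ t) = Finset.range t := by
    ext i; simp only [Finset.mem_filter, Finset.mem_range]; omega
  rw [this, Finset.card_range]

lemma pexp_const {n : ℕ} (c : ℝ) : pexp (fun _ : Equiv.Perm (Fin n) => c) = c := by
  have : (n.factorial : ℝ) ≠ 0 := by exact_mod_cast n.factorial_ne_zero
  simp only [pexp, Finset.sum_const, Finset.card_univ, Fintype.card_perm, Fintype.card_fin,
    nsmul_eq_mul]
  field_simp

lemma pexp_sub {n : ℕ} (f g : Equiv.Perm (Fin n) → ℝ) :
    pexp (fun σ => f σ - g σ) = pexp f - pexp g := by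
  simp [pexp, Finset.sum_sub_distrib, sub_div]

lemma pexp_const_mul {n : ℕ} (c : ℝ) (f : Equiv.Perm (Fin n) → ℝ) :
    pexp (fun σ => c * f σ) = c * pexp f := by
  simp [pexp, ← Finset.mul_sum, mul_div_assoc]

lemma pexp_sum {n : ℕ} {ι : Type*} (s : Finset ι) (f : ι → Equiv.Perm (Fin n) → ℝ) :
    pexp (fun σ => ∑ i ∈ s, f i σ) = ∑ i ∈ s, pexp (f i) := by
  unfold pexp
  rw [Finset.sum_comm, Finset.sum_div]

lemma pexp_mul_right {n : ℕ} (τ : Equiv.Perm (Fin n)) (f : Equiv.Perm (Fin n) → ℝ) :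
    pexp (fun σ => f (σ * τ)) = pexp f := by
  unfold pexp
  rw [Equiv.sum_comp (Equiv.mulRight τ) f |>.symm]
  simp

lemma pcov_eq {n : ℕ} (f g : Equiv.Perm (Fin n) → ℝ) :
    pcov f g = pexp (fun σ => f σ * g σ) - pexp f * pexp g := by
  have h : (fun σ => (f σ - pexp f) * (g σ - pexp g)) =
      fun σ => (f σ * g σ - pexp g * f σ) - (pexp f * g σ - pexp f * pexp g) := by
    funext σ; ring
  rw [pcov, h, pexp_sub, pexp_sub, pexp_sub, pexp_const_mul, pexp_const_mul, pexp_const]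
  ring

lemma pcov_sum_sum {n : ℕ} {ι κ : Type*} (s : Finset ι) (r : Finset κ)
    (f : ι → Equiv.Perm (Fin n) → ℝ) (g : κ → Equiv.Perm (Fin n) → ℝ) :
    pcov (fun σ => ∑ i ∈ s, f i σ) (fun σ => ∑ j ∈ r, g j σ) =
      ∑ i ∈ s, ∑ j ∈ r, pcov (f i) (g j) := by
  simp only [pcov_eq, Finset.sum_mul_sum, pexp_sum, Finset.sum_sub_distrib]

/-- Sampling without replacement: adding one more individual to a set `S` of individuals with low
labels multiplies the probability by `(t - |S|) / (n - |S|)`. -/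
lemma pexp_prod_insert {n t : ℕ} (ht : t ≤ n) {S : Finset (Fin n)} {w : Fin n} (hw : w ∉ S) :
    ((n : ℝ) - S.card) * pexp (fun σ => ∏ u ∈ insert w S, lowInd t u σ) =
      ((t : ℝ) - S.card) * pexp (fun σ => ∏ u ∈ S, lowInd t u σ) := by
  set g : Equiv.Perm (Fin n) → ℝ := fun σ => ∏ u ∈ S, lowInd t u σ with hg
  have htot : ∑ v, pexp (fun σ => lowInd t v σ * g σ) = t * pexp g := by
    rw [← pexp_sum, ← pexp_const_mul]
    congr 1; funext σ
    rw [← Finset.sum_mul, sum_lowInd ht]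
  have hin : ∀ v ∈ S, pexp (fun σ => lowInd t v σ * g σ) = pexp g := by
    intro v hv
    congr 1; funext σ
    simp only [hg]
    rw [← Finset.mul_prod_erase S _ hv, ← mul_assoc, lowInd_mul_self]
  have hout : ∀ v ∈ Sᶜ, pexp (fun σ => lowInd t v σ * g σ) =
      pexp (fun σ => lowInd t w σ * g σ) := by
    intro v hv
    rw [Finset.mem_compl] at hv
    rw [← pexp_mul_right (Equiv.swap v w)]
    congr 1; funext σ
    have hv' : lowInd t v (σ * Equiv.swap v w) = lowInd t w σ := by simp [lowInd]
    rw [hv']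
    congr 1
    refine Finset.prod_congr rfl fun u hu => ?_
    have h1 : u ≠ v := fun h => hv (h ▸ hu)
    have h2 : u ≠ w := fun h => hw (h ▸ hu)
    simp [lowInd, Equiv.swap_apply_of_ne_of_ne h1 h2]
  rw [← Finset.sum_add_sum_compl S, Finset.sum_congr rfl hin, Finset.sum_congr rfl hout,
    Finset.sum_const, Finset.sum_const, Finset.card_compl, Fintype.card_fin, nsmul_eq_mul,
    nsmul_eq_mul, Nat.cast_sub (by simpa using S.card_le_univ)] at htot
  simp only [Finset.prod_insert hw]
  linarith

lemma pexp_lowInd {n t : ℕ} (ht : t ≤ n) (hn : 3 ≤ n) (u : Fin n) :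
    pexp (lowInd t u) = t / n := by
  have h := pexp_prod_insert ht (Finset.notMem_empty u)
  have hn' : (3 : ℝ) ≤ n := by exact_mod_cast hn
  simp only [insert_empty_eq, Finset.prod_singleton, Finset.prod_empty, Finset.card_empty,
    Nat.cast_zero, sub_zero, pexp_const, mul_one] at h
  rw [eq_div_iff (by linarith), mul_comm]
  exact h

lemma pexp_lowInd_mul {n t : ℕ} (ht : t ≤ n) (hn : 3 ≤ n) {u v : Fin n} (huv : u ≠ v) :
    pexp (fun σ => lowInd t u σ * lowInd t v σ) = t * (t - 1) / (n * (n - 1)) := by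
  have h := pexp_prod_insert (S := {v}) ht (by simpa using huv)
  have hn' : (3 : ℝ) ≤ n := by exact_mod_cast hn
  simp only [Finset.prod_pair huv, Finset.prod_singleton, Finset.card_singleton,
    Nat.cast_one] at h
  have h' : ((n : ℝ) - 1) * pexp (fun σ => lowInd t u σ * lowInd t v σ) =
      (t - 1) * (t / n) := by rw [h]; congr 1; exact pexp_lowInd ht hn v
  have h0 : (n : ℝ) ≠ 0 := by linarith
  have h1 : (n : ℝ) - 1 ≠ 0 := by linarith
  field_simp at h' ⊢
  linarith

lemma pexp_lowInd_mul_mul {n t : ℕ} (ht : t ≤ n) (hn : 3 ≤ n) {u v w : Fin n} (huv : u ≠ v)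
    (hwu : w ≠ u) (hwv : w ≠ v) :
    pexp (fun σ => lowInd t w σ * (lowInd t u σ * lowInd t v σ)) =
      t * (t - 1) * (t - 2) / (n * (n - 1) * (n - 2)) := by
  have hw : w ∉ ({u, v} : Finset (Fin n)) := by simp [hwu, hwv]
  have h := pexp_prod_insert ht hw
  have hn' : (3 : ℝ) ≤ n := by exact_mod_cast hn
  simp only [Finset.prod_insert hw, Finset.prod_pair huv, Finset.card_pair huv,
    Nat.cast_ofNat, pexp_lowInd_mul ht hn huv] at h
  have h0 : (n : ℝ) ≠ 0 := by linarith
  have h1 : (n : ℝ) - 1 ≠ 0 := by linarith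
  have h2 : (n : ℝ) - 2 ≠ 0 := by linarith
  field_simp at h ⊢
  linarith

lemma pcov_edgeInd {n ℓ t : ℕ} (ht : t ≤ n) (hn : 3 ≤ n) {e f : Sym2 (Node n ℓ)}
    (he : ¬ (indPair e).IsDiag) {w : Fin n} (hf : indPair f = s(w, w)) :
    pcov (edgeInd t e) (edgeInd t f) =
      (t : ℝ) * ((t : ℝ) - 1) * ((n : ℝ) - t) / ((n : ℝ) * ((n : ℝ) - 1) * ((n : ℝ) - 2)) *
        ((if w ∈ indPair e then 1 else 0) - 2 / (n : ℝ)) := by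
  induction e using Sym2.ind with | _ x y
  induction f using Sym2.ind with | _ p q
  have hxy : x.1 ≠ y.1 := by simpa [indPair] using he
  have hpq : p.1 = w ∧ q.1 = w := by simpa [indPair] using hf
  have hE : edgeInd t s(x, y) = fun σ => lowInd t x.1 σ * lowInd t y.1 σ :=
    funext (edgeInd_mk t x y)
  have hF : edgeInd t s(p, q) = lowInd t w := by
    funext σ; rw [edgeInd_mk, hpq.1, hpq.2, lowInd_mul_self]
  have hmem : w ∈ indPair s(x, y) ↔ w = x.1 ∨ w = y.1 := by simp [indPair]
  have hn' : (3 : ℝ) ≤ n := by exact_mod_cast hn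
  have h0 : (n : ℝ) ≠ 0 := by linarith
  have h1 : (n : ℝ) - 1 ≠ 0 := by linarith
  have h2 : (n : ℝ) - 2 ≠ 0 := by linarith
  rw [hE, hF, pcov_eq, pexp_lowInd_mul ht hn hxy, pexp_lowInd ht hn]
  by_cases hw : w = x.1 ∨ w = y.1
  · have : (fun σ => lowInd t x.1 σ * lowInd t y.1 σ * lowInd t w σ) =
        fun σ => lowInd t x.1 σ * lowInd t y.1 σ := by
      funext σ
      rcases hw with rfl | rfl
      · rw [mul_right_comm, lowInd_mul_self]
      · rw [mul_assoc, lowInd_mul_self]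
    rw [this, pexp_lowInd_mul ht hn hxy, if_pos (hmem.2 hw)]
    field_simp
  · rw [if_neg (fun h => hw (hmem.1 h))]
    rw [not_or] at hw
    have := pexp_lowInd_mul_mul ht hn hxy hw.1 hw.2
    simp only [mul_comm (lowInd t w _)] at this
    rw [this]
    field_simp
    ring

lemma Ddeg_eq_card {n ℓ : ℕ} (Gr : Finset (Sym2 (Node n ℓ))) (u : Fin n) :
    Ddeg Gr u = ((Gout Gr).filter fun e => u ∈ indPair e).card := by
  unfold Ddeg D
  rw [← Finset.card_biUnion]
  · congr 1
    ext e
    simp only [Gout, Finset.mem_biUnion, Finset.mem_filter, Finset.mem_univ, true_and]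
    constructor
    · rintro ⟨v, hv, he, h⟩
      rw [h]
      exact ⟨⟨he, by simpa using hv.symm⟩, by simp⟩
    · rintro ⟨⟨he, hd⟩, hu⟩
      obtain ⟨v, hv⟩ := hu
      refine ⟨v, ?_, he, hv⟩
      rintro rfl
      exact hd (by simp [hv])
  · intro v _ v' _ hvv'
    refine Finset.disjoint_left.2 fun e h h' => hvv' ?_
    simp only [Finset.mem_filter] at h h'
    exact Sym2.congr_right.1 (h.2.symm.trans h'.2)

lemma D_self_eq_card {n ℓ : ℕ} (Gr : Finset (Sym2 (Node n ℓ))) (u : Fin n) :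
    D Gr u u = ((Gin Gr).filter fun f => indPair f = s(u, u)).card := by
  unfold D Gin
  rw [Finset.filter_filter]
  congr 1
  refine Finset.filter_congr fun e _ => ?_
  constructor
  · intro h; exact ⟨by simp [h], h⟩
  · exact fun h => h.2

lemma sum_D_mul_Ddeg {n ℓ : ℕ} (Gr : Finset (Sym2 (Node n ℓ))) :
    ∑ u, (D Gr u u : ℝ) * (Ddeg Gr u : ℝ) =
      ∑ e ∈ Gout Gr, ∑ f ∈ Gin Gr, ∑ u,
        (if indPair f = s(u, u) then 1 else 0) * (if u ∈ indPair e then 1 else 0) := by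
  simp only [D_self_eq_card, Ddeg_eq_card, ← Finset.sum_boole, Finset.sum_mul_sum]
  rw [Finset.sum_comm' (t' := Gin Gr) (s' := fun _ => Finset.univ) (by simp),
    Finset.sum_comm (s := Gout Gr)]
  exact Finset.sum_congr rfl fun f _ => Finset.sum_comm

/-- Covariance of `R_out,1(t)` and `R_in,1(t)` under the permutation null
distribution. -/
theorem cov_Rout1_Rin1 (n ℓ : ℕ) (Gr : Finset (Sym2 (Node n ℓ)))
    (hG : ∀ e ∈ Gr, ¬ e.IsDiag) (hn : 3 ≤ n) (t : ℕ) (ht1 : 1 ≤ t) (ht2 : t ≤ n - 1) :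
    pcov (fun σ => (Rout1 Gr t σ : ℝ)) (fun σ => (Rin1 Gr t σ : ℝ)) =
      (t : ℝ) * ((t : ℝ) - 1) * ((n : ℝ) - t) / ((n : ℝ) * ((n : ℝ) - 1) * ((n : ℝ) - 2)) *
        ((∑ u : Fin n, (D Gr u u : ℝ) * (Ddeg Gr u : ℝ)) -
          2 / (n : ℝ) * ((Gin Gr).card : ℝ) * ((Gout Gr).card : ℝ)) := by
  have ht : t ≤ n := by omega
  have hO : (fun σ => (Rout1 Gr t σ : ℝ)) = fun σ => ∑ e ∈ Gout Gr, edgeInd t e σ := by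
    funext σ; simp only [Rout1, edgeInd, Finset.sum_boole]
  have hI : (fun σ => (Rin1 Gr t σ : ℝ)) = fun σ => ∑ f ∈ Gin Gr, edgeInd t f σ := by
    funext σ; simp only [Rin1, edgeInd, Finset.sum_boole]
  have hcard : 2 / (n : ℝ) * ((Gin Gr).card : ℝ) * ((Gout Gr).card : ℝ) =
      ∑ e ∈ Gout Gr, ∑ f ∈ Gin Gr, 2 / (n : ℝ) := by
    simp only [Finset.sum_const, nsmul_eq_mul]
    ring
  rw [hO, hI, pcov_sum_sum, sum_D_mul_Ddeg, hcard, ← Finset.sum_sub_distrib, Finset.mul_sum]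
  refine Finset.sum_congr rfl fun e he => ?_
  rw [← Finset.sum_sub_distrib, Finset.mul_sum]
  refine Finset.sum_congr rfl fun f hf => ?_
  obtain ⟨w, hw⟩ : ∃ w, indPair f = s(w, w) := by
    have hd := (Finset.mem_filter.1 hf).2
    induction h : indPair f using Sym2.ind with | _ a b
    rw [h, Sym2.mk_isDiag_iff] at hd
    exact ⟨a, by rw [hd]⟩
  rw [pcov_edgeInd ht hn (Finset.mem_filter.1 he).2 hw, hw, Finset.sum_eq_single w]
  · simp
  · intro u _ hu
    have : s(w, w) ≠ s(u, u) := by simpa using hu.symm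
    simp [this]
  · simp

end CPD
end
end

section
/- Under the permutation null distribution, for n ≥ 4 and every integer t with 1 ≤ t ≤ n−1, the weighted and difference edge-count statistics are uncorrelated: Cov(R_out,w(t), R_out,d(t)) = 0. -/
open scoped BigOperators Classical

noncomputable section

namespace CPD

/-- The indicator that the permuted label of individual `u` is at most `t`. -/
def labelInd {n : ℕ} (t : ℕ) (σ : Equiv.Perm (Fin n)) (u : Fin n) : ℝ :=
  if (σ u : ℕ) < t then 1 else 0

/-- The centred version of `labelInd`. -/
def centredInd {n : ℕ} (t : ℕ) (σ : Equiv.Perm (Fin n)) (u : Fin n) : ℝ :=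
  labelInd t σ u - (t : ℝ) / n

/-- The contribution of a pair of individuals to `(n - 2) * Routw`. -/
def pairWeight {n : ℕ} (t : ℕ) (σ : Equiv.Perm (Fin n)) (u v : Fin n) : ℝ :=
  ((n : ℝ) - t - 1) * (labelInd t σ u * labelInd t σ v) +
    ((t : ℝ) - 1) * ((1 - labelInd t σ u) * (1 - labelInd t σ v))

lemma labelInd_mul {n : ℕ} (t : ℕ) (σ τ : Equiv.Perm (Fin n)) (u : Fin n) :
    labelInd t (σ * τ) u = labelInd t σ (τ u) := rfl

lemma labelInd_mul_self {n : ℕ} (t : ℕ) (σ : Equiv.Perm (Fin n)) (u : Fin n) :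
    labelInd t σ u * labelInd t σ u = labelInd t σ u := by
  unfold labelInd
  split_ifs <;> simp

lemma sum_labelInd {n : ℕ} {t : ℕ} (ht : t ≤ n) (σ : Equiv.Perm (Fin n)) :
    ∑ u, labelInd t σ u = t := by
  have h := Equiv.sum_comp σ fun i : Fin n => if (i : ℕ) < t then (1 : ℝ) else 0
  unfold labelInd
  rw [h, Fin.sum_univ_eq_sum_range (fun i => if i < t then (1 : ℝ) else 0) n,
    Finset.sum_boole]
  congr 1
  rw [show (Finset.range n).filter (· < t) = Finset.range t by
    ext i; simp only [Finset.mem_filter, Finset.mem_range]; omega]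
  exact Finset.card_range t

lemma sum_centredInd {n : ℕ} {t : ℕ} (hn : n ≠ 0) (ht : t ≤ n) (σ : Equiv.Perm (Fin n)) :
    ∑ u, centredInd t σ u = 0 := by
  have : (n : ℝ) ≠ 0 := Nat.cast_ne_zero.mpr hn
  simp only [centredInd, Finset.sum_sub_distrib, sum_labelInd ht]
  simp
  field_simp
  simp

lemma sum_perm_centredInd {n : ℕ} {t : ℕ} (hn : n ≠ 0) (ht : t ≤ n) (u : Fin n) :
    ∑ σ : Equiv.Perm (Fin n), centredInd t σ u = 0 := by
  have hconst : ∀ v, ∑ σ : Equiv.Perm (Fin n), centredInd t σ v =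
      ∑ σ : Equiv.Perm (Fin n), centredInd t σ u := fun v => by
    rw [← Equiv.sum_comp (Equiv.mulRight (Equiv.swap u v))]
    simp [centredInd, labelInd_mul]
  have hsum : ∑ v : Fin n, ∑ σ : Equiv.Perm (Fin n), centredInd t σ v = 0 := by
    rw [Finset.sum_comm]
    exact Finset.sum_eq_zero fun σ _ => sum_centredInd hn ht σ
  simpa [hconst, hn] using hsum

/-- Summed over all partners `v ≠ u`, the weights of the pairs containing `u` do not depend on
the permutation. -/
lemma sum_pairWeight {n : ℕ} {t : ℕ} (ht : t ≤ n) (σ : Equiv.Perm (Fin n)) (u : Fin n) :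
    ∑ v ∈ Finset.univ.erase u, pairWeight t σ u v = ((n : ℝ) - t - 1) * ((t : ℝ) - 1) := by
  have hx := labelInd_mul_self t σ u
  rw [Finset.sum_erase_eq_sub (Finset.mem_univ u)]
  simp only [pairWeight, Finset.sum_add_distrib, ← Finset.mul_sum, Finset.sum_sub_distrib,
    sum_labelInd ht]
  simp only [Finset.sum_const, Finset.card_univ, Fintype.card_fin, nsmul_eq_mul, mul_one]
  linear_combination (2 - n : ℝ) * hx

lemma sum_pairWeight_mul_centredInd_left {n : ℕ} {t : ℕ} (ht : t ≤ n)
    {u v : Fin n} (huv : u ≠ v) :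
    ∑ σ : Equiv.Perm (Fin n), pairWeight t σ u v * centredInd t σ u = 0 := by
  have hn : n ≠ 0 := (Fin.pos u).ne'
  have hconst : ∀ w ∈ Finset.univ.erase u,
      ∑ σ : Equiv.Perm (Fin n), pairWeight t σ u w * centredInd t σ u =
        ∑ σ : Equiv.Perm (Fin n), pairWeight t σ u v * centredInd t σ u := fun w hw => by
    rw [← Equiv.sum_comp (Equiv.mulRight (Equiv.swap v w))]
    simp [pairWeight, centredInd, labelInd_mul,
      Equiv.swap_apply_of_ne_of_ne huv (Finset.ne_of_mem_erase hw).symm]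
  have hsum : ∑ w ∈ Finset.univ.erase u,
      ∑ σ : Equiv.Perm (Fin n), pairWeight t σ u w * centredInd t σ u = 0 := by
    rw [Finset.sum_comm]
    simp only [← Finset.sum_mul, sum_pairWeight ht]
    rw [← Finset.mul_sum, sum_perm_centredInd hn ht, mul_zero]
  rw [Finset.sum_congr rfl hconst, Finset.sum_const, nsmul_eq_mul] at hsum
  refine (mul_eq_zero.mp hsum).resolve_left (Nat.cast_ne_zero.mpr ?_)
  exact (Finset.card_pos.mpr ⟨v, by simpa using huv.symm⟩).ne'

lemma pairWeight_comm {n : ℕ} (t : ℕ) (σ : Equiv.Perm (Fin n)) (u v : Fin n) :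
    pairWeight t σ u v = pairWeight t σ v u := by
  unfold pairWeight
  ring

lemma sum_pairWeight_mul_centredInd {n : ℕ} {t : ℕ} (ht : t ≤ n)
    {u v : Fin n} (huv : u ≠ v) (k : Fin n) :
    ∑ σ : Equiv.Perm (Fin n), pairWeight t σ u v * centredInd t σ k = 0 := by
  have hu := sum_pairWeight_mul_centredInd_left ht huv
  have hv : ∑ σ : Equiv.Perm (Fin n), pairWeight t σ u v * centredInd t σ v = 0 := by
    simpa only [pairWeight_comm] using sum_pairWeight_mul_centredInd_left ht huv.symm
  by_cases hku : k = u
  · rwa [hku]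
  by_cases hkv : k = v
  · rwa [hkv]
  have hconst : ∀ w, w ≠ u → w ≠ v →
      ∑ σ : Equiv.Perm (Fin n), pairWeight t σ u v * centredInd t σ w =
        ∑ σ : Equiv.Perm (Fin n), pairWeight t σ u v * centredInd t σ k := fun w hwu hwv => by
    rw [← Equiv.sum_comp (Equiv.mulRight (Equiv.swap k w))]
    simp [pairWeight, centredInd, labelInd_mul,
      Equiv.swap_apply_of_ne_of_ne (Ne.symm hku) hwu.symm,
      Equiv.swap_apply_of_ne_of_ne (Ne.symm hkv) hwv.symm]
  have hsum : ∑ w : Fin n,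
      ∑ σ : Equiv.Perm (Fin n), pairWeight t σ u v * centredInd t σ w = 0 := by
    rw [Finset.sum_comm]
    simp only [← Finset.mul_sum, sum_centredInd (Fin.pos u).ne' ht, mul_zero,
      Finset.sum_const_zero]
  rw [← Finset.sum_erase (f := fun w => ∑ σ : Equiv.Perm (Fin n),
      pairWeight t σ u v * centredInd t σ w) _ hu, ← Finset.sum_erase (a := v) _ hv,
    Finset.sum_congr rfl fun w hw => hconst w (by simp_all) (by simp_all),
    Finset.sum_const, nsmul_eq_mul] at hsum
  refine (mul_eq_zero.mp hsum).resolve_left (Nat.cast_ne_zero.mpr ?_)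
  exact (Finset.card_pos.mpr ⟨k, by simp [hku, hkv]⟩).ne'

/-- The indicator that both endpoints of `e` have permuted label at most `t`. -/
def edgeInd1 {n ℓ : ℕ} (t : ℕ) (σ : Equiv.Perm (Fin n)) (e : Sym2 (Node n ℓ)) : ℝ :=
  if ∀ x ∈ e, ((σ x.1 : ℕ) + 1 ≤ t) then 1 else 0

/-- The indicator that both endpoints of `e` have permuted label greater than `t`. -/
def edgeInd2 {n ℓ : ℕ} (t : ℕ) (σ : Equiv.Perm (Fin n)) (e : Sym2 (Node n ℓ)) : ℝ :=
  if ∀ x ∈ e, (t ≤ (σ x.1 : ℕ)) then 1 else 0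

lemma Rout1_eq_sum {n ℓ : ℕ} (Gr : Finset (Sym2 (Node n ℓ))) (t : ℕ)
    (σ : Equiv.Perm (Fin n)) : (Rout1 Gr t σ : ℝ) = ∑ e ∈ Gout Gr, edgeInd1 t σ e := by
  simp only [Rout1, edgeInd1, Finset.sum_boole]

lemma Rout2_eq_sum {n ℓ : ℕ} (Gr : Finset (Sym2 (Node n ℓ))) (t : ℕ)
    (σ : Equiv.Perm (Fin n)) : (Rout2 Gr t σ : ℝ) = ∑ e ∈ Gout Gr, edgeInd2 t σ e := by
  simp only [Rout2, edgeInd2, Finset.sum_boole]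

lemma edgeInd1_mk {n ℓ : ℕ} (t : ℕ) (σ : Equiv.Perm (Fin n)) (a b : Node n ℓ) :
    edgeInd1 t σ s(a, b) = labelInd t σ a.1 * labelInd t σ b.1 := by
  by_cases ha : (σ a.1 : ℕ) < t <;> by_cases hb : (σ b.1 : ℕ) < t <;>
    simp [edgeInd1, labelInd, Sym2.mem_iff, ha, hb]

lemma edgeInd2_mk {n ℓ : ℕ} (t : ℕ) (σ : Equiv.Perm (Fin n)) (a b : Node n ℓ) :
    edgeInd2 t σ s(a, b) = (1 - labelInd t σ a.1) * (1 - labelInd t σ b.1) := by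
  by_cases ha : (σ a.1 : ℕ) < t <;> by_cases hb : (σ b.1 : ℕ) < t <;>
    simp [edgeInd2, labelInd, Sym2.mem_iff, ha, hb, Nat.le_of_not_lt, Nat.not_le_of_lt]

lemma exists_of_mem_Gout {n ℓ : ℕ} {Gr : Finset (Sym2 (Node n ℓ))} {e : Sym2 (Node n ℓ)}
    (he : e ∈ Gout Gr) : ∃ a b : Node n ℓ, e = s(a, b) ∧ a.1 ≠ b.1 := by
  induction e with
  | _ a b => exact ⟨a, b, rfl, by simpa [indPair] using (Finset.mem_filter.mp he).2⟩

/-- The contribution of an edge to `Routd`, centred at its expectation. -/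
def edgeDiff {n ℓ : ℕ} (t : ℕ) (σ : Equiv.Perm (Fin n)) (e : Sym2 (Node n ℓ)) : ℝ :=
  edgeInd1 t σ e - edgeInd2 t σ e - (2 * ((t : ℝ) / n) - 1)

lemma edgeDiff_mk {n ℓ : ℕ} (t : ℕ) (σ : Equiv.Perm (Fin n)) (a b : Node n ℓ) :
    edgeDiff t σ s(a, b) = centredInd t σ a.1 + centredInd t σ b.1 := by
  rw [edgeDiff, edgeInd1_mk, edgeInd2_mk, centredInd, centredInd]
  ring

lemma Routd_sub_eq_sum {n ℓ : ℕ} (Gr : Finset (Sym2 (Node n ℓ))) (t : ℕ)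
    (σ : Equiv.Perm (Fin n)) :
    Routd Gr t σ - (Gout Gr).card * (2 * ((t : ℝ) / n) - 1) =
      ∑ e ∈ Gout Gr, edgeDiff t σ e := by
  simp only [Routd, Rout1_eq_sum, Rout2_eq_sum, edgeDiff,
    Finset.sum_sub_distrib (f := fun e => edgeInd1 t σ e - edgeInd2 t σ e),
    Finset.sum_sub_distrib (f := edgeInd1 t σ), Finset.sum_const, nsmul_eq_mul]

lemma Routw_eq_sum {n ℓ : ℕ} (Gr : Finset (Sym2 (Node n ℓ))) (t : ℕ)
    (σ : Equiv.Perm (Fin n)) :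
    Routw Gr t σ = (∑ e ∈ Gout Gr, (((n : ℝ) - t - 1) * edgeInd1 t σ e +
      ((t : ℝ) - 1) * edgeInd2 t σ e)) / ((n : ℝ) - 2) := by
  simp only [Routw, Rout1_eq_sum, Rout2_eq_sum, Finset.mul_sum, Finset.sum_add_distrib]

lemma pcov_eq_zero {n : ℕ} {f g : Equiv.Perm (Fin n) → ℝ} (c : ℝ)
    (hg : ∑ σ, (g σ - c) = 0) (hfg : ∑ σ, f σ * (g σ - c) = 0) : pcov f g = 0 := by
  have hfac : (n.factorial : ℝ) ≠ 0 := Nat.cast_ne_zero.mpr n.factorial_ne_zero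
  have hc : pexp g = c := by
    rw [Finset.sum_sub_distrib, Finset.sum_const, Finset.card_univ, Fintype.card_perm,
      Fintype.card_fin, nsmul_eq_mul, sub_eq_zero] at hg
    rw [pexp, hg, mul_div_cancel_left₀ _ hfac]
  rw [pcov, hc, pexp]
  simp only [sub_mul (f _), Finset.sum_sub_distrib, ← Finset.mul_sum, hfg, hg]
  simp

/-- The weighted and difference edge-count statistics are uncorrelated under the
permutation null distribution. -/
theorem cov_Routw_Routd (n ℓ : ℕ) (Gr : Finset (Sym2 (Node n ℓ)))
    (hG : ∀ e ∈ Gr, ¬ e.IsDiag) (hn : 4 ≤ n) (t : ℕ) (ht1 : 1 ≤ t) (ht2 : t ≤ n - 1) :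
    pcov (Routw Gr t) (Routd Gr t) = 0 := by
  have htn : t ≤ n := ht2.trans (Nat.sub_le n 1)
  refine pcov_eq_zero ((Gout Gr).card * (2 * ((t : ℝ) / n) - 1)) ?_ ?_
  · simp only [Routd_sub_eq_sum]
    rw [Finset.sum_comm]
    refine Finset.sum_eq_zero fun e he => ?_
    obtain ⟨a, b, rfl, -⟩ := exists_of_mem_Gout he
    simp only [edgeDiff_mk, Finset.sum_add_distrib,
      sum_perm_centredInd (by omega : n ≠ 0) htn, add_zero]
  · simp only [Routd_sub_eq_sum, Routw_eq_sum, div_mul_eq_mul_div, ← Finset.sum_div,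
      Finset.sum_mul_sum]
    rw [Finset.sum_comm, Finset.sum_eq_zero, zero_div]
    intro e he
    rw [Finset.sum_comm]
    refine Finset.sum_eq_zero fun e' he' => ?_
    obtain ⟨a, b, rfl, hab⟩ := exists_of_mem_Gout he
    obtain ⟨c, d, rfl, -⟩ := exists_of_mem_Gout he'
    have hw := sum_pairWeight_mul_centredInd htn hab
    simp only [pairWeight] at hw
    simp only [edgeDiff_mk, edgeInd1_mk, edgeInd2_mk, mul_add (_ + _),
      Finset.sum_add_distrib, hw, add_zero]

end CPD
end
end
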